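/- arXiv:2511.14267 — 2 statements merged into one kernel-verified Lean document; each statement's English description precedes it below -/
import Mathlib

section
/- Let σ > 0, Γ ≥ 0, and τ ∈ ℝ. Then Σ_{r∈ℤ, |r|≤Γ} exp(τ·r − r²/(2σ²)) ≤ exp(σ²τ²/2) · Σ_{r∈ℤ, |r|≤Γ} exp(−r²/(2σ²)). Equivalently, the moment-generating function of the truncated discrete Gaussian distribution with parameters σ and Γ is bounded by exp(σ²τ²/2) for every τ ∈ ℝ (sub-Gaussianity with proxy variance σ²). -/
lemma gauss_summable (σ τ : ℝ) (hσ : 0 < σ) :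
    Summable (fun r : ℤ => Real.exp (τ * r - (r : ℝ) ^ 2 / (2 * σ ^ 2))) := by
  have h := summable_pow_mul_jacobiTheta₂_term_bound (|τ| / (2 * Real.pi))
    (T := 1 / (2 * σ ^ 2 * Real.pi)) (by positivity) 0
  refine h.of_nonneg_of_le (fun r => (Real.exp_pos _).le) (fun r => ?_)
  rw [pow_zero, one_mul, Real.exp_le_exp]
  have hpi := Real.pi_ne_zero
  have e : -Real.pi * (1 / (2 * σ ^ 2 * Real.pi) * (r : ℝ) ^ 2
      - 2 * (|τ| / (2 * Real.pi)) * ((|r| : ℤ) : ℝ)) = |τ| * |(r : ℝ)| - (r : ℝ) ^ 2 / (2 * σ ^ 2) := by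
    push_cast
    field_simp
    ring
  rw [e, ← abs_mul]
  linarith [le_abs_self (τ * (r : ℝ))]

lemma gauss_full (σ τ : ℝ) (hσ : 0 < σ) :
    (∑' r : ℤ, Real.exp (τ * r - (r : ℝ) ^ 2 / (2 * σ ^ 2))) ≤
      Real.exp (σ ^ 2 * τ ^ 2 / 2) * ∑' r : ℤ, Real.exp (-(r : ℝ) ^ 2 / (2 * σ ^ 2)) := by
  have hpi := Real.pi_ne_zero
  have hσ0 := hσ.ne'
  set a : ℝ := 1 / (2 * Real.pi * σ ^ 2) with ha
  have hapos : 0 < a := by positivity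
  have hs : Summable (fun n : ℤ => Real.exp (-Real.pi / a * (n : ℝ) ^ 2)) := by
    refine (gauss_summable (1 / (2 * Real.pi * σ)) 0 (by positivity)).congr (fun n => ?_)
    congr 1
    rw [ha]; field_simp; ring
  have key : ∀ t : ℝ, ((∑' r : ℤ, Real.exp (t * r - (r : ℝ) ^ 2 / (2 * σ ^ 2)) : ℝ) : ℂ) =
      1 / (a : ℂ) ^ (1 / 2 : ℂ) * ∑' n : ℤ,
        Complex.exp (-Real.pi / a * ((n : ℂ) + Complex.I * ((t / (2 * Real.pi) : ℝ) : ℂ)) ^ 2) := by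
    intro t
    rw [← Complex.tsum_exp_neg_quadratic (by simpa using hapos), Complex.ofReal_tsum]
    refine tsum_congr fun n => ?_
    rw [Complex.ofReal_exp]
    congr 1
    have : t * n - (n : ℝ) ^ 2 / (2 * σ ^ 2) =
      -Real.pi * a * n ^ 2 + 2 * Real.pi * (t / (2 * Real.pi)) * n := by
      rw [ha]; field_simp; ring
    rw [this]; push_cast; ring
  have nrm : ∀ n : ℤ, ‖Complex.exp (-Real.pi / a * ((n : ℂ) +
      Complex.I * ((τ / (2 * Real.pi) : ℝ) : ℂ)) ^ 2)‖ =
      Real.exp (σ ^ 2 * τ ^ 2 / 2) * Real.exp (-Real.pi / a * (n : ℝ) ^ 2) := by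
    intro n
    rw [Complex.norm_exp, ← Real.exp_add]
    congr 1
    have : (-Real.pi / a * ((n : ℂ) + Complex.I * ((τ / (2 * Real.pi) : ℝ) : ℂ)) ^ 2) =
      ((-Real.pi / a * ((n : ℝ) ^ 2 - (τ / (2 * Real.pi)) ^ 2) : ℝ) : ℂ) +
      ((-Real.pi / a * (2 * n * (τ / (2 * Real.pi))) : ℝ) : ℂ) * Complex.I := by
      push_cast
      linear_combination (-Real.pi / a * ((τ : ℂ) / (2 * Real.pi)) ^ 2) * Complex.I_sq
    rw [this]
    simp only [Complex.add_re, Complex.ofReal_re, Complex.re_ofReal_mul, Complex.I_re, mul_zero,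
      add_zero]
    rw [ha]; field_simp; ring
  have k0 := key 0
  have kt := key τ
  have z0 : ∀ n : ℤ, Complex.exp (-Real.pi / a * ((n : ℂ) +
      Complex.I * (((0 : ℝ) / (2 * Real.pi) : ℝ) : ℂ)) ^ 2) =
      ((Real.exp (-Real.pi / a * (n : ℝ) ^ 2) : ℝ) : ℂ) := by
    intro n; simp
  simp_rw [z0] at k0
  rw [← Complex.ofReal_tsum] at k0
  have k0' := congrArg norm k0
  have kt' := congrArg norm kt
  rw [norm_mul, Complex.norm_real, Real.norm_of_nonneg (tsum_nonneg fun _ => (Real.exp_pos _).le)]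
    at k0' kt'
  rw [Complex.norm_real, Real.norm_of_nonneg (tsum_nonneg fun _ => (Real.exp_pos _).le)] at k0'
  have e0 : ∀ r : ℤ, Real.exp (-(r : ℝ) ^ 2 / (2 * σ ^ 2)) =
      Real.exp (0 * r - (r : ℝ) ^ 2 / (2 * σ ^ 2)) := fun r => by congr 1; ring
  simp_rw [e0]
  rw [k0', kt', mul_left_comm, ← tsum_mul_left]
  refine mul_le_mul_of_nonneg_left ?_ (norm_nonneg _)
  refine (norm_tsum_le_tsum_norm ?_).trans (le_of_eq (tsum_congr nrm))
  simp_rw [nrm]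
  exact hs.mul_left _

theorem stmt12 (σ Γ τ : ℝ) (hσ : 0 < σ) (hΓ : 0 ≤ Γ) :
    (∑' r : ℤ, if |(r : ℝ)| ≤ Γ then
        Real.exp (τ * r - (r : ℝ) ^ 2 / (2 * σ ^ 2)) else 0) ≤
      Real.exp (σ ^ 2 * τ ^ 2 / 2) *
        ∑' r : ℤ, if |(r : ℝ)| ≤ Γ then Real.exp (-(r : ℝ) ^ 2 / (2 * σ ^ 2)) else 0 := by
  have hfull := gauss_full σ τ hσ
  set K := Real.exp (σ ^ 2 * τ ^ 2 / 2) with hK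
  set w : ℤ → ℝ := fun r => Real.exp (-(r : ℝ) ^ 2 / (2 * σ ^ 2)) with hw
  have hwpos : ∀ r, 0 < w r := fun r => Real.exp_pos _
  have hsw : Summable w := (gauss_summable σ 0 hσ).congr fun r => by
    simp only [hw]; congr 1; ring
  have hsp := gauss_summable σ τ hσ
  have hsn := gauss_summable σ (-τ) hσ
  have hcosh : ∀ r : ℤ, w r * Real.cosh (τ * r) =
      (Real.exp (τ * r - (r : ℝ) ^ 2 / (2 * σ ^ 2)) +
        Real.exp (-τ * r - (r : ℝ) ^ 2 / (2 * σ ^ 2))) / 2 := by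
    intro r
    rw [Real.cosh_eq, sub_eq_add_neg, sub_eq_add_neg, Real.exp_add, Real.exp_add]
    simp only [hw, neg_div, neg_mul]; ring
  have hsc : Summable (fun r : ℤ => w r * Real.cosh (τ * r)) := by
    simp_rw [hcosh]; exact (hsp.add hsn).div_const 2
  -- restrictions are summable
  have hres : ∀ f : ℤ → ℝ, Summable f →
      Summable (fun r : ℤ => if |(r : ℝ)| ≤ Γ then f r else 0) := by
    intro f hf
    exact (hf.indicator {r : ℤ | |(r : ℝ)| ≤ Γ}).congr fun r => by
      simp [Set.indicator_apply]
  -- symmetrization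
  have hsymm : ∀ p : ℝ → Prop, ∀ _ : DecidablePred p,
      Summable (fun r : ℤ => if p |(r : ℝ)| then
        Real.exp (τ * r - (r : ℝ) ^ 2 / (2 * σ ^ 2)) else 0) →
      (∑' r : ℤ, if p |(r : ℝ)| then Real.exp (τ * r - (r : ℝ) ^ 2 / (2 * σ ^ 2)) else 0) =
      ∑' r : ℤ, if p |(r : ℝ)| then w r * Real.cosh (τ * r) else 0 := by
    intro p _ hs
    set g : ℤ → ℝ := fun r => if p |(r : ℝ)| then
        Real.exp (τ * r - (r : ℝ) ^ 2 / (2 * σ ^ 2)) else 0 with hg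
    have h1 : ∑' r, g (-r) = ∑' r, g r := (Equiv.neg ℤ).tsum_eq g
    have hs' : Summable fun r => g (-r) := (Equiv.neg ℤ).summable_iff.mpr hs
    have h2 : ∑' r, (g r + g (-r)) / 2 = ∑' r, g r := by
      rw [tsum_div_const, hs.tsum_add hs', h1]; ring
    rw [← h2]
    refine tsum_congr fun r => ?_
    simp only [hg, Int.cast_neg, abs_neg]
    split_ifs
    · rw [hcosh]; simp
    · simp
  have hA := hsymm (fun x => x ≤ Γ) (Classical.decPred _) (by convert hres _ hsp)
  have hT := hsymm (fun _ => True) (Classical.decPred _) (by simpa using hsp)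
  simp only [if_true] at hT
  rw [hT] at hfull
  have hA' : (∑' r : ℤ, if |(r : ℝ)| ≤ Γ then
        Real.exp (τ * r - (r : ℝ) ^ 2 / (2 * σ ^ 2)) else 0) =
      ∑' r : ℤ, if |(r : ℝ)| ≤ Γ then w r * Real.cosh (τ * r) else 0 := by
    convert hA
  rw [hA', ← tsum_mul_left]
  have hR : Summable (fun r : ℤ => K * if |(r : ℝ)| ≤ Γ then w r else 0) :=
    (hres _ hsw).mul_left K
  rcases le_total (Real.cosh (τ * Γ)) K with hM | hM
  · refine (hres _ hsc).tsum_le_tsum (fun r => ?_) hR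
    split_ifs with h
    · rw [mul_comm K]
      refine mul_le_mul_of_nonneg_left (le_trans ?_ hM) (hwpos r).le
      rw [Real.cosh_le_cosh, abs_mul, abs_mul, abs_of_nonneg hΓ]
      exact mul_le_mul_of_nonneg_left h (abs_nonneg _)
    · simp
  · have h3 : (∑' r : ℤ, ((if |(r : ℝ)| ≤ Γ then w r * Real.cosh (τ * r) else 0) -
        K * if |(r : ℝ)| ≤ Γ then w r else 0)) ≤
        ∑' r : ℤ, (w r * Real.cosh (τ * r) - K * w r) := by
      refine ((hres _ hsc).sub hR).tsum_le_tsum (fun r => ?_) (hsc.sub (hsw.mul_left K))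
      split_ifs with h
      · exact le_rfl
      · have : K ≤ Real.cosh (τ * r) := by
          refine hM.trans ?_
          rw [Real.cosh_le_cosh, abs_mul, abs_mul, abs_of_nonneg hΓ]
          exact mul_le_mul_of_nonneg_left (not_le.mp h).le (abs_nonneg _)
        have := mul_le_mul_of_nonneg_left this (hwpos r).le
        linarith
    rw [(hres _ hsc).tsum_sub hR, hsc.tsum_sub (hsw.mul_left K), tsum_mul_left (f := w)] at h3
    linarith
end

section
/- Let σ > 0 and Γ ≥ 0. Then Σ_{r∈ℤ, |r|≤Γ} r²·exp(−r²/(2σ²)) ≤ σ² · Σ_{r∈ℤ, |r|≤Γ} exp(−r²/(2σ²)). Equivalently, the second moment (= variance) of the truncated discrete Gaussian distribution with parameters σ and Γ is at most σ². -/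
open Real Filter Topology in
lemma aux_summable (k : ℕ) {a : ℝ} (ha : 0 < a) :
    Summable (fun n : ℤ => (|(n : ℝ)|) ^ k * Real.exp (-π * a * (n : ℝ) ^ 2)) := by
  have h := summable_pow_mul_jacobiTheta₂_term_bound 0 ha k
  refine h.congr ?_
  intro n
  push_cast
  congr 2
  ring

open Real Filter Topology in
lemma aux_summable0 {a : ℝ} (ha : 0 < a) :
    Summable (fun n : ℤ => Real.exp (-π * a * (n : ℝ) ^ 2)) := by
  simpa using aux_summable 0 ha

open Real Filter Topology in
lemma aux_summable2 {a : ℝ} (ha : 0 < a) :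
    Summable (fun n : ℤ => (n : ℝ) ^ 2 * Real.exp (-π * a * (n : ℝ) ^ 2)) := by
  simpa using aux_summable 2 ha

open Real Filter Topology in
lemma aux_func {x : ℝ} (hx : 0 < x) :
    x * ∑' n : ℤ, Real.exp (-π * x ^ 2 * (n : ℝ) ^ 2)
      = ∑' n : ℤ, Real.exp (-π * (x ^ 2)⁻¹ * (n : ℝ) ^ 2) := by
  rw [Real.tsum_exp_neg_mul_int_sq (by positivity : 0 < x ^ 2), ← Real.sqrt_eq_rpow,
    Real.sqrt_sq hx.le, ← mul_assoc, mul_one_div_cancel hx.ne', one_mul]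
  simp only [div_eq_mul_inv]

open Real Filter Topology in
lemma aux_full {b : ℝ} (hb : 0 < b) :
    2 * π * b ^ 2 * ∑' n : ℤ, (n : ℝ) ^ 2 * Real.exp (-π * b ^ 2 * (n : ℝ) ^ 2)
      ≤ ∑' n : ℤ, Real.exp (-π * b ^ 2 * (n : ℝ) ^ 2) := by
  set M := ∑' n : ℤ, (n : ℝ) ^ 2 * Real.exp (-π * b ^ 2 * (n : ℝ) ^ 2) with hM
  set G := ∑' n : ℤ, Real.exp (-π * b ^ 2 * (n : ℝ) ^ 2) with hG
  have key : ∀ x, 0 < x → x < b → x * π * (b + x) * M ≤ G := by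
    intro x hx hxb
    have hsq : x ^ 2 < b ^ 2 := by nlinarith
    have h1 : x * ∑' n : ℤ, Real.exp (-π * x ^ 2 * (n : ℝ) ^ 2) ≤ b * G := by
      rw [hG, aux_func hx, aux_func hb]
      refine (aux_summable0 (by positivity)).tsum_le_tsum (fun n => ?_)
        (aux_summable0 (by positivity))
      apply Real.exp_le_exp.mpr
      have : (b ^ 2)⁻¹ ≤ (x ^ 2)⁻¹ := by gcongr
      have h3 : 0 ≤ π * (n : ℝ) ^ 2 := by positivity
      nlinarith
    have h2 : π * (b ^ 2 - x ^ 2) * M + G ≤ ∑' n : ℤ, Real.exp (-π * x ^ 2 * (n : ℝ) ^ 2) := by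
      have hs2 := aux_summable2 (by positivity : 0 < b ^ 2)
      have hs0 := aux_summable0 (by positivity : 0 < b ^ 2)
      rw [hM, hG, ← tsum_mul_left, ← (hs2.mul_left _).tsum_add hs0]
      refine ((hs2.mul_left _).add hs0).tsum_le_tsum (fun n => ?_)
        (aux_summable0 (by positivity))
      have h3 := Real.add_one_le_exp (π * (b ^ 2 - x ^ 2) * (n : ℝ) ^ 2)
      have h4 : Real.exp (-π * x ^ 2 * (n : ℝ) ^ 2)
          = Real.exp (π * (b ^ 2 - x ^ 2) * (n : ℝ) ^ 2) * Real.exp (-π * b ^ 2 * (n : ℝ) ^ 2) := by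
        rw [← Real.exp_add]; congr 1; ring
      rw [h4]
      have h5 := mul_le_mul_of_nonneg_right h3 (Real.exp_pos (-π * b ^ 2 * (n : ℝ) ^ 2)).le
      linarith
    have h6 := mul_le_mul_of_nonneg_left h2 hx.le
    have h7 : (b - x) * (x * π * (b + x) * M) ≤ (b - x) * G := by linarith
    exact le_of_mul_le_mul_left h7 (by linarith)
  have hc : Tendsto (fun x : ℝ => x * π * (b + x) * M) (𝓝[<] b) (𝓝 (b * π * (b + b) * M)) := by
    apply Tendsto.mono_left _ nhdsWithin_le_nhds
    apply Continuous.tendsto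
    fun_prop
  have := le_of_tendsto hc (b := G) (by
    filter_upwards [Ioo_mem_nhdsLT hb] with x hx using key x hx.1 hx.2)
  linarith

theorem stmt13 (σ Γ : ℝ) (hσ : 0 < σ) (hΓ : 0 ≤ Γ) :
    (∑' r : ℤ, if |(r : ℝ)| ≤ Γ then
        (r : ℝ) ^ 2 * Real.exp (-(r : ℝ) ^ 2 / (2 * σ ^ 2)) else 0) ≤
      σ ^ 2 * ∑' r : ℤ, if |(r : ℝ)| ≤ Γ then Real.exp (-(r : ℝ) ^ 2 / (2 * σ ^ 2)) else 0 := by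
  have hpi := Real.pi_pos
  obtain ⟨b, hb, hbσ⟩ : ∃ b : ℝ, 0 < b ∧ 2 * Real.pi * b ^ 2 * σ ^ 2 = 1 := by
    refine ⟨√(1 / (2 * Real.pi * σ ^ 2)), by positivity, ?_⟩
    rw [Real.sq_sqrt (by positivity)]
    field_simp
  have he : ∀ r : ℤ, Real.exp (-(r : ℝ) ^ 2 / (2 * σ ^ 2))
      = Real.exp (-Real.pi * b ^ 2 * (r : ℝ) ^ 2) := by
    intro r
    congr 1
    rw [div_eq_iff (by positivity)]
    linear_combination (r : ℝ) ^ 2 * hbσ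
  simp only [he]
  have hs0 := aux_summable0 (by positivity : 0 < b ^ 2)
  have hs2 := aux_summable2 (by positivity : 0 < b ^ 2)
  have hfull := aux_full hb
  have ht0 : Summable (fun r : ℤ => if |(r : ℝ)| ≤ Γ then
      Real.exp (-Real.pi * b ^ 2 * (r : ℝ) ^ 2) else 0) := by
    refine (hs0.indicator {r : ℤ | |(r : ℝ)| ≤ Γ}).congr (fun r => ?_)
    simp [Set.indicator_apply]
  have ht2 : Summable (fun r : ℤ => if |(r : ℝ)| ≤ Γ then
      (r : ℝ) ^ 2 * Real.exp (-Real.pi * b ^ 2 * (r : ℝ) ^ 2) else 0) := by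
    refine (hs2.indicator {r : ℤ | |(r : ℝ)| ≤ Γ}).congr (fun r => ?_)
    simp [Set.indicator_apply]
  by_cases hc : Γ ≤ σ
  · rw [← tsum_mul_left]
    refine ht2.tsum_le_tsum (fun r => ?_) (ht0.mul_left _)
    split_ifs with h
    · have : (r : ℝ) ^ 2 ≤ σ ^ 2 := by
        rw [← sq_abs (r : ℝ)]
        have := abs_nonneg (r : ℝ)
        gcongr
        linarith
      gcongr
    · simp
  · push Not at hc
    have hf : ∑' n : ℤ, (n : ℝ) ^ 2 * Real.exp (-Real.pi * b ^ 2 * (n : ℝ) ^ 2)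
      ≤ σ ^ 2 * ∑' n : ℤ, Real.exp (-Real.pi * b ^ 2 * (n : ℝ) ^ 2) := by
      have := mul_le_mul_of_nonneg_left hfull (sq_nonneg σ)
      refine le_trans (le_of_eq ?_) this
      rw [← mul_assoc, mul_comm (σ ^ 2), hbσ, one_mul]
    rw [← tsum_mul_left] at hf ⊢
    have hd := (ht2.sub (ht0.mul_left (σ ^ 2))).tsum_le_tsum (g := fun n : ℤ =>
      (n : ℝ) ^ 2 * Real.exp (-Real.pi * b ^ 2 * (n : ℝ) ^ 2)
        - σ ^ 2 * Real.exp (-Real.pi * b ^ 2 * (n : ℝ) ^ 2)) (fun r => by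
        split_ifs with h
        · exact le_rfl
        · have : σ ^ 2 ≤ (r : ℝ) ^ 2 := by
            rw [← sq_abs (r : ℝ)]
            gcongr
            linarith
          have h2 := mul_le_mul_of_nonneg_right this
            (Real.exp_pos (-Real.pi * b ^ 2 * (r : ℝ) ^ 2)).le
          linarith) (hs2.sub (hs0.mul_left _))
    rw [ht2.tsum_sub (ht0.mul_left _), hs2.tsum_sub (hs0.mul_left _)] at hd
    linarith
end
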